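/- Under hypotheses H(A), H(J), H(γ,f) and (H_s), for every finite-dimensional subspace V^h ⊆ V the discrete problem P_opt^h has a unique solution: there exists exactly one u^h ∈ V^h such that 0 belongs to the Clarke subdifferential at u^h of the restriction of v ↦ ℒ(u^h, v) to V^h. -/

import Mathlib

open Filter Topology

/-- Clarke generalized directional derivative of `j` at `x` in direction `v`. -/
noncomputable def clarkeDeriv {Y : Type*} [NormedAddCommGroup Y] [NormedSpace ℝ Y]
    (j : Y → ℝ) (x v : Y) : ℝ :=
  Filter.limsup (fun p : Y × ℝ => (j (p.1 + p.2 • v) - j p.1) / p.2)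
    ((nhds x) ×ˢ (nhdsWithin (0 : ℝ) (Set.Ioi (0 : ℝ))))

/-- Clarke generalized subdifferential of `j` at `x`. -/
noncomputable def clarkeSubdiff {Y : Type*} [NormedAddCommGroup Y] [NormedSpace ℝ Y]
    (j : Y → ℝ) (x : Y) : Set (Y →L[ℝ] ℝ) :=
  {ξ : Y →L[ℝ] ℝ | ∀ v : Y, ξ v ≤ clarkeDeriv j x v}

theorem eventually_snd_pos_nhds_prod_nhdsGT {Y : Type*} [TopologicalSpace Y] (x : Y) :
    ∀ᶠ p in 𝓝 x ×ˢ 𝓝[>] (0 : ℝ), 0 < p.2 :=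
  tendsto_snd.eventually self_mem_nhdsWithin

section Clarke

variable {Y : Type*} [NormedAddCommGroup Y] [NormedSpace ℝ Y]

theorem tendsto_add_smul_nhds_prod_nhdsGT (x v : Y) :
    Tendsto (fun p : Y × ℝ => p.1 + p.2 • v) (𝓝 x ×ˢ 𝓝[>] (0 : ℝ)) (𝓝 x) := by
  have h : Tendsto (fun p : Y × ℝ => p.1 + p.2 • v) (𝓝 (x, (0 : ℝ))) (𝓝 (x + (0 : ℝ) • v)) :=
    Continuous.tendsto (by fun_prop) (x, (0 : ℝ))
  rw [zero_smul, add_zero, nhds_prod_eq] at h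
  exact h.mono_left (Filter.prod_mono le_rfl nhdsWithin_le_nhds)

theorem LocallyLipschitz.eventually_abs_slope_le {j : Y → ℝ} (hj : LocallyLipschitz j) (x : Y) :
    ∃ L : ℝ, 0 ≤ L ∧ ∀ v : Y, ∀ᶠ p in 𝓝 x ×ˢ 𝓝[>] (0 : ℝ),
      |(j (p.1 + p.2 • v) - j p.1) / p.2| ≤ L * ‖v‖ := by
  obtain ⟨K, t, ht, hK⟩ := hj x
  refine ⟨K, K.2, fun v => ?_⟩
  filter_upwards [eventually_snd_pos_nhds_prod_nhdsGT x,
    (tendsto_add_smul_nhds_prod_nhdsGT x v).eventually_mem ht,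
    tendsto_fst.eventually_mem ht] with p hp h₁ h₂
  have h := hK.dist_le_mul _ h₁ _ h₂
  rw [Real.dist_eq, dist_eq_norm, add_sub_cancel_left, norm_smul, Real.norm_of_nonneg hp.le] at h
  rw [abs_div, abs_of_pos hp, div_le_iff₀ hp]
  linarith

theorem LocallyLipschitz.isBoundedUnder_slope {j : Y → ℝ} (hj : LocallyLipschitz j) (x v : Y) :
    (𝓝 x ×ˢ 𝓝[>] (0 : ℝ)).IsBoundedUnder (· ≤ ·)
      (fun p : Y × ℝ => (j (p.1 + p.2 • v) - j p.1) / p.2) := by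
  obtain ⟨L, -, hL⟩ := hj.eventually_abs_slope_le x
  exact isBoundedUnder_of_eventually_le ((hL v).mono fun p hp => (abs_le.1 hp).2)

theorem LocallyLipschitz.eventually_slope_lt {j : Y → ℝ} (hj : LocallyLipschitz j) {x v : Y}
    {r : ℝ} (hr : clarkeDeriv j x v < r) :
    ∀ᶠ p in 𝓝 x ×ˢ 𝓝[>] (0 : ℝ), (j (p.1 + p.2 • v) - j p.1) / p.2 < r :=
  eventually_lt_of_limsup_lt hr (hj.isBoundedUnder_slope x v)

theorem LocallyLipschitz.clarkeDeriv_le {j : Y → ℝ} (hj : LocallyLipschitz j) {x v : Y} {c : ℝ}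
    (h : ∀ r > c, ∀ᶠ p in 𝓝 x ×ˢ 𝓝[>] (0 : ℝ), (j (p.1 + p.2 • v) - j p.1) / p.2 ≤ r) :
    clarkeDeriv j x v ≤ c := by
  refine le_of_forall_gt_imp_ge_of_dense fun r hr => limsup_le_of_le ?_ (h r hr)
  obtain ⟨L, -, hL⟩ := hj.eventually_abs_slope_le x
  exact (isBoundedUnder_of_eventually_ge
    ((hL v).mono fun p hp => (abs_le.1 hp).1)).isCoboundedUnder_le

theorem LocallyLipschitz.le_clarkeDeriv {j : Y → ℝ} (hj : LocallyLipschitz j) {x v : Y} {c : ℝ}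
    (h : ∃ᶠ p in 𝓝 x ×ˢ 𝓝[>] (0 : ℝ), c ≤ (j (p.1 + p.2 • v) - j p.1) / p.2) :
    c ≤ clarkeDeriv j x v :=
  le_limsup_of_frequently_le h (hj.isBoundedUnder_slope x v)

theorem clarkeDeriv_nonneg_of_forall_le {j : Y → ℝ} (hj : LocallyLipschitz j) {x : Y}
    (hx : ∀ y, j x ≤ j y) (v : Y) : 0 ≤ clarkeDeriv j x v := by
  have ht : Tendsto (fun s : ℝ => (x, s)) (𝓝[>] (0 : ℝ)) (𝓝 x ×ˢ 𝓝[>] (0 : ℝ)) :=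
    tendsto_const_nhds.prodMk tendsto_id
  refine hj.le_clarkeDeriv (ht.frequently (Eventually.frequently ?_))
  filter_upwards [self_mem_nhdsWithin] with s hs
  exact div_nonneg (sub_nonneg.2 (hx _)) (le_of_lt hs)

theorem zero_mem_clarkeSubdiff_iff {j : Y → ℝ} {x : Y} :
    0 ∈ clarkeSubdiff j x ↔ ∀ v, 0 ≤ clarkeDeriv j x v :=
  Iff.rfl

/-- Strong monotonicity of the Clarke derivative yields quadratic growth. -/
theorem exists_quadratic_lower_bound {φ : Y → ℝ} (hφ : LocallyLipschitz φ) {c : ℝ}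
    (hmono : ∀ x y, clarkeDeriv φ x (y - x) + clarkeDeriv φ y (x - y) ≤ -(c * ‖x - y‖ ^ 2)) :
    ∃ L : ℝ, ∀ v, φ 0 + c / 2 * ‖v‖ ^ 2 - L * ‖v‖ ≤ φ v := by
  obtain ⟨L, -, hL⟩ := hφ.eventually_abs_slope_le 0
  refine ⟨L, fun v => ?_⟩
  have hLd : ∀ w, -(L * ‖w‖) ≤ clarkeDeriv φ 0 w := fun w =>
    hφ.le_clarkeDeriv ((hL w).mono fun p hp => (abs_le.1 hp).1).frequently
  have hray : ContinuousOn (fun t : ℝ => -φ (t • v)) (Set.Icc 0 1) :=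
    (hφ.continuous.comp (by fun_prop : Continuous fun t : ℝ => t • v)).neg.continuousOn
  have hB : ∀ t : ℝ, HasDerivAt
      (fun t : ℝ => -φ 0 - c / 2 * ‖v‖ ^ 2 * t ^ 2 + L * ‖v‖ * t)
      (-(c * ‖v‖ ^ 2 * t) + L * ‖v‖) t := fun t => by
    convert! (((hasDerivAt_pow 2 t).const_mul (c / 2 * ‖v‖ ^ 2)).const_sub (-φ 0)).add
      ((hasDerivAt_id t).const_mul (L * ‖v‖)) using 1
    simp; ring
  have key := image_le_of_liminf_slope_right_le_deriv_boundary hray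
    (B := fun t : ℝ => -φ 0 - c / 2 * ‖v‖ ^ 2 * t ^ 2 + L * ‖v‖ * t)
    (B' := fun t => -(c * ‖v‖ ^ 2 * t) + L * ‖v‖) (by simp)
    (fun t _ => (hB t).continuousAt.continuousWithinAt)
    (fun t _ => (hB t).hasDerivWithinAt) ?_ (Set.right_mem_Icc.2 zero_le_one)
  · simp only [one_smul, one_pow, mul_one] at key
    linarith
  intro t ht r hr
  refine Eventually.frequently ?_
  rcases ht.1.eq_or_lt with rfl | htpos
  · have h0 : Tendsto (fun s : ℝ => ((0 : Y), s)) (𝓝[>] (0 : ℝ)) (𝓝 0 ×ˢ 𝓝[>] (0 : ℝ)) :=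
      tendsto_const_nhds.prodMk tendsto_id
    filter_upwards [h0.eventually (hL v), self_mem_nhdsWithin] with s hs hs0
    rw [slope_def_field]
    have h := (abs_le.1 hs).1
    simp only [zero_add, zero_smul, sub_zero, mul_zero, neg_zero] at h hr ⊢
    have h' : (-φ (s • v) - -φ 0) / s = -((φ (s • v) - φ 0) / s) := by ring
    linarith
  · have hd : clarkeDeriv φ (t • v) (-(t • v)) < t * r := by
      have h₁ := hmono (t • v) 0
      have h₂ := hLd (t • v)
      rw [zero_sub, sub_zero, norm_smul, Real.norm_of_nonneg htpos.le] at h₁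
      rw [norm_smul, Real.norm_of_nonneg htpos.le] at h₂
      have h₃ := mul_lt_mul_of_pos_left hr htpos
      nlinarith
    have hs : Tendsto (fun s : ℝ => (s • v, (s - t) / t)) (𝓝[>] t)
        (𝓝 (t • v) ×ˢ 𝓝[>] (0 : ℝ)) := by
      refine Tendsto.prodMk ?_ (tendsto_nhdsWithin_iff.2 ⟨?_, ?_⟩)
      · exact (Continuous.tendsto (by fun_prop) t).mono_left nhdsWithin_le_nhds
      · have h : Tendsto (fun s : ℝ => (s - t) / t) (𝓝 t) (𝓝 ((t - t) / t)) :=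
          Continuous.tendsto (by fun_prop) t
        rw [sub_self, zero_div] at h
        exact h.mono_left nhdsWithin_le_nhds
      · filter_upwards [self_mem_nhdsWithin] with s hs
        exact div_pos (sub_pos.2 hs) htpos
    filter_upwards [hs.eventually (hφ.eventually_slope_lt hd), self_mem_nhdsWithin] with s h hst
    have hst' : 0 < s - t := sub_pos.2 hst
    have hpt : s • v + ((s - t) / t) • -(t • v) = t • v := by
      rw [smul_neg, smul_smul, div_mul_cancel₀ _ htpos.ne', sub_smul]
      abel
    simp only [hpt] at h
    rw [div_lt_iff₀ (div_pos hst' htpos)] at h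
    rw [slope_def_field, div_lt_iff₀ hst']
    have h' : t * r * ((s - t) / t) = r * (s - t) := by field_simp
    linarith

theorem exists_forall_le_of_clarkeDeriv_strongly_monotone [FiniteDimensional ℝ Y] {φ : Y → ℝ}
    (hφ : LocallyLipschitz φ) {c : ℝ} (hc : 0 < c)
    (hmono : ∀ x y, clarkeDeriv φ x (y - x) + clarkeDeriv φ y (x - y) ≤ -(c * ‖x - y‖ ^ 2)) :
    ∃ x, ∀ y, φ x ≤ φ y := by
  obtain ⟨L, hL⟩ := exists_quadratic_lower_bound hφ hmono
  have : ProperSpace Y := FiniteDimensional.proper ℝ Y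
  refine hφ.continuous.exists_forall_le' 0 ?_
  filter_upwards [(tendsto_norm_cocompact_atTop (E := Y)).eventually_ge_atTop (2 * |L| / c)]
    with v hv
  rw [div_le_iff₀ hc] at hv
  have h := hL v
  have := mul_le_mul_of_nonneg_right hv (norm_nonneg v)
  have := mul_le_mul_of_nonneg_right (le_abs_self L) (norm_nonneg v)
  nlinarith

theorem clarkeDeriv_add_comp_le {X : Type*} [NormedAddCommGroup X] [NormedSpace ℝ X]
    {F : Y → ℝ} {F' : Y →L[ℝ] ℝ} {u : Y} (hF : HasStrictFDerivAt F F' u) (γ : Y →L[ℝ] X)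
    {j : X → ℝ} (hj : LocallyLipschitz j) (hsum : LocallyLipschitz fun v => F v + j (γ v)) (v : Y) :
    clarkeDeriv (fun v => F v + j (γ v)) u v ≤ F' v + clarkeDeriv j (γ u) (γ v) := by
  refine hsum.clarkeDeriv_le fun r hr => ?_
  set ε := (r - (F' v + clarkeDeriv j (γ u) (γ v))) / 2 with hε_def
  have hε : 0 < ε := by linarith
  have hδ : 0 < ε / (‖v‖ + 1) := by positivity
  have hpair : Tendsto (fun p : Y × ℝ => (p.1 + p.2 • v, p.1)) (𝓝 u ×ˢ 𝓝[>] (0 : ℝ))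
      (𝓝 (u, u)) := by
    rw [nhds_prod_eq]
    exact (tendsto_add_smul_nhds_prod_nhdsGT u v).prodMk tendsto_fst
  have hγ : Tendsto (fun p : Y × ℝ => (γ p.1, p.2)) (𝓝 u ×ˢ 𝓝[>] (0 : ℝ))
      (𝓝 (γ u) ×ˢ 𝓝[>] (0 : ℝ)) :=
    ((γ.continuous.tendsto u).comp tendsto_fst).prodMk tendsto_snd
  filter_upwards [eventually_snd_pos_nhds_prod_nhdsGT u,
    hpair.eventually (hF.isLittleO.def hδ),
    hγ.eventually (hj.eventually_slope_lt (lt_add_of_pos_right (clarkeDeriv j (γ u) (γ v)) hε))]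
    with p hp h₁ h₂
  simp only [add_sub_cancel_left, map_smul, norm_smul, Real.norm_of_nonneg hp.le, smul_eq_mul,
    Real.norm_eq_abs] at h₁
  have h₃ : ε / (‖v‖ + 1) * (p.2 * ‖v‖) ≤ ε * p.2 := by
    rw [div_mul_eq_mul_div, div_le_iff₀ (by positivity)]
    nlinarith [mul_pos hε hp]
  have h₄ := (abs_le.1 (h₁.trans h₃)).2
  rw [div_lt_iff₀ hp] at h₂
  simp only [map_add, map_smul]
  rw [div_le_iff₀ hp]
  have h₅ : r = 2 * ε + (F' v + clarkeDeriv j (γ u) (γ v)) := by rw [hε_def]; ring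
  rw [h₅]
  linarith

end Clarke

theorem hasFDerivAt_of_hasLineDerivAt_of_lipschitz {V : Type*} [NormedAddCommGroup V]
    [NormedSpace ℝ V] {F : V → ℝ} {A : V → V →L[ℝ] ℝ} {L : ℝ}
    (hlip : ∀ u v, ‖A u - A v‖ ≤ L * ‖u - v‖)
    (hF : ∀ u v, HasLineDerivAt ℝ F (A u v) u v) (u : V) : HasFDerivAt F (A u) u := by
  have hline : ∀ x t, HasDerivAt (fun t : ℝ => F (u + t • x)) (A (u + t • x) x) t := fun x t => by
    have h : HasDerivAt (fun s : ℝ => F (u + t • x + s • x)) (A (u + t • x) x) (t - t) := by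
      rw [sub_self]; exact hF (u + t • x) x
    have h' := h.comp_sub_const t t
    refine h'.congr_of_eventuallyEq (Eventually.of_forall fun s => ?_)
    simp only [add_assoc, ← add_smul, add_sub_cancel]
  have hquad : ∀ x, |F (u + x) - F u - A u x| ≤ |L| * ‖x‖ ^ 2 := fun x => by
    obtain ⟨t, ht, h⟩ := exists_hasDerivAt_eq_slope (fun t : ℝ => F (u + t • x))
      (fun t => A (u + t • x) x) zero_lt_one
      (fun t _ => (hline x t).continuousAt.continuousWithinAt) (fun t _ => hline x t)
    simp only [one_smul, zero_smul, add_zero, sub_zero, div_one] at h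
    rw [← h, ← sub_apply, ← Real.norm_eq_abs]
    refine ((A (u + t • x) - A u).le_opNorm x).trans ?_
    have h₁ := hlip (u + t • x) u
    rw [add_sub_cancel_left, norm_smul, Real.norm_of_nonneg ht.1.le] at h₁
    have h₂ : L * (t * ‖x‖) ≤ |L| * ‖x‖ := by
      have := mul_le_mul_of_nonneg_right ht.2.le (norm_nonneg x)
      have := mul_nonneg ht.1.le (norm_nonneg x)
      exact mul_le_mul (le_abs_self L) (by linarith) this (abs_nonneg L)
    calc _ ≤ |L| * ‖x‖ * ‖x‖ := mul_le_mul_of_nonneg_right (h₁.trans h₂) (norm_nonneg x)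
      _ = _ := by ring
  rw [hasFDerivAt_iff_isLittleO_nhds_zero]
  refine Asymptotics.IsBigO.trans_isLittleO (g := fun x : V => ‖x‖ ^ 2)
    (Asymptotics.IsBigO.of_bound |L| (Eventually.of_forall fun x => ?_))
    (Asymptotics.isLittleO_norm_pow_id one_lt_two)
  simpa using hquad x

/-- A family of functionals whose Clarke derivatives are jointly strongly monotone, up to a small
Lipschitz dependence on the parameter, has exactly one self-consistent critical point. -/
theorem existsUnique_zero_mem_clarkeSubdiff {E : Type*} [NormedAddCommGroup E] [NormedSpace ℝ E]
    [FiniteDimensional ℝ E] {φ : E → E → ℝ} (hφ : ∀ w, LocallyLipschitz (φ w)) {c k : ℝ}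
    (hk : 0 ≤ k) (hkc : k < c)
    (hmono : ∀ w₁ w₂ v₁ v₂, clarkeDeriv (φ w₁) v₁ (v₂ - v₁) + clarkeDeriv (φ w₂) v₂ (v₁ - v₂)
      ≤ -(c * ‖v₁ - v₂‖ ^ 2) + k * ‖w₁ - w₂‖ * ‖v₁ - v₂‖) :
    ∃! u, (0 : E →L[ℝ] ℝ) ∈ clarkeSubdiff (φ u) u := by
  have hc : 0 < c := hk.trans_lt hkc
  have hcontr : ∀ w₁ w₂ v₁ v₂, 0 ∈ clarkeSubdiff (φ w₁) v₁ → 0 ∈ clarkeSubdiff (φ w₂) v₂ →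
      c * ‖v₁ - v₂‖ ≤ k * ‖w₁ - w₂‖ := by
    intro w₁ w₂ v₁ v₂ h₁ h₂
    have h₃ := zero_mem_clarkeSubdiff_iff.1 h₁ (v₂ - v₁)
    have h₄ := zero_mem_clarkeSubdiff_iff.1 h₂ (v₁ - v₂)
    have h₅ := hmono w₁ w₂ v₁ v₂
    rcases (norm_nonneg (v₁ - v₂)).eq_or_lt with h | h
    · rw [← h, mul_zero]; positivity
    · exact le_of_mul_le_mul_right (by nlinarith) h
  have hmin : ∀ w, ∃ v, 0 ∈ clarkeSubdiff (φ w) v := fun w => by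
    obtain ⟨v, hv⟩ := exists_forall_le_of_clarkeDeriv_strongly_monotone (hφ w) hc
      fun x y => by simpa using hmono w w x y
    exact ⟨v, zero_mem_clarkeSubdiff_iff.2 (clarkeDeriv_nonneg_of_forall_le (hφ w) hv)⟩
  choose T hT using hmin
  have : CompleteSpace E := FiniteDimensional.complete ℝ E
  have hcw : ContractingWith (Real.toNNReal (k / c)) T := by
    refine ⟨?_, LipschitzWith.of_dist_le_mul fun x y => ?_⟩
    · rwa [← NNReal.coe_lt_coe, Real.coe_toNNReal _ (by positivity), NNReal.coe_one, div_lt_one hc]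
    · rw [Real.coe_toNNReal _ (by positivity), dist_eq_norm, dist_eq_norm, div_mul_eq_mul_div,
        le_div_iff₀ hc, mul_comm]
      exact hcontr x y _ _ (hT x) (hT y)
  refine ⟨hcw.fixedPoint T, ?_, fun u hu => ?_⟩
  · have h := hT (hcw.fixedPoint T)
    rwa [hcw.fixedPoint_isFixedPt] at h
  · refine hcw.fixedPoint_unique ?_
    have h := hcontr u u _ _ (hT u) hu
    rw [sub_self, norm_zero, mul_zero] at h
    have h' : ‖T u - u‖ ≤ 0 := by
      by_contra! hpos
      exact absurd h (not_le.2 (mul_pos hc hpos))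
    exact sub_eq_zero.1 (norm_le_zero_iff.1 h')

theorem stmt11
    {V : Type*} [NormedAddCommGroup V] [NormedSpace ℝ V] [CompleteSpace V]
    {X : Type*} [NormedAddCommGroup X] [NormedSpace ℝ X] [CompleteSpace X]
    (hV_refl : Function.Surjective (NormedSpace.inclusionInDoubleDual ℝ V))
    (A : V → V →L[ℝ] ℝ) (F_A : V → ℝ) (L_A : ℝ) (hL_A : 0 < L_A)
    (hA_lip : ∀ u v : V, ‖A u - A v‖ ≤ L_A * ‖u - v‖)
    (hA_pot : ∀ u v : V, HasLineDerivAt ℝ F_A (A u v) u v)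
    (m_A : ℝ) (hm_A : 0 < m_A)
    (hA_mono : ∀ u v : V, m_A * ‖u - v‖ ^ 2 ≤ (A u - A v) (u - v))
    (J : X → X → ℝ)
    (hJ_lip : ∀ w : X, LocallyLipschitz (J w))
    (c₀ c₁ c₂ : ℝ) (hc₀ : 0 ≤ c₀) (hc₁ : 0 ≤ c₁) (hc₂ : 0 ≤ c₂)
    (hJ_bdd : ∀ w v : X, ∀ ξ ∈ clarkeSubdiff (J w) v, ‖ξ‖ ≤ c₀ + c₁ * ‖v‖ + c₂ * ‖w‖)
    (m_α m_L : ℝ) (hm_α : 0 ≤ m_α) (hm_L : 0 ≤ m_L)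
    (hJ_mono : ∀ w₁ w₂ v₁ v₂ : X,
      clarkeDeriv (J w₁) v₁ (v₂ - v₁) + clarkeDeriv (J w₂) v₂ (v₁ - v₂)
        ≤ m_α * ‖v₁ - v₂‖ ^ 2 + m_L * ‖w₁ - w₂‖ * ‖v₁ - v₂‖)
    (γ : V →L[ℝ] X) (f : V →L[ℝ] ℝ)
    (hs : (m_α + m_L) * ‖γ‖ ^ 2 < m_A)
    (Vh : Submodule ℝ V) (hVh : FiniteDimensional ℝ Vh) :
    ∃! uh : Vh, (0 : Vh →L[ℝ] ℝ) ∈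
      clarkeSubdiff (fun v : Vh => F_A ↑v - f ↑v + J (γ ↑uh) (γ ↑v)) uh := by
  have hFd := hasFDerivAt_of_hasLineDerivAt_of_lipschitz hA_lip hA_pot
  have hAcont : Continuous A := by
    have : LipschitzWith (Real.toNNReal L_A) A := LipschitzWith.of_dist_le_mul fun u v => by
      rw [Real.coe_toNNReal _ hL_A.le, dist_eq_norm, dist_eq_norm]
      exact hA_lip u v
    exact this.continuous
  have hFC : ContDiff ℝ 1 F_A := contDiff_one_iff_hasFDerivAt.2 ⟨A, hAcont, hFd⟩
  have hstrict : ∀ u : Vh, HasStrictFDerivAt (fun v : Vh => F_A ↑v - f ↑v)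
      ((A u - f).comp Vh.subtypeL) u := fun u =>
    HasStrictFDerivAt.comp (g := fun v : V => F_A v - f v) u
      ((hasStrictFDerivAt_of_hasFDerivAt_of_continuousAt (Eventually.of_forall hFd)
        hAcont.continuousAt).sub f.hasStrictFDerivAt) Vh.subtypeL.hasStrictFDerivAt
  have hFlip : LocallyLipschitz fun v : Vh => F_A ↑v - f ↑v :=
    ((hFC.sub f.contDiff).comp Vh.subtypeL.contDiff).locallyLipschitz
  have hφ : ∀ w : Vh, LocallyLipschitz fun v : Vh => F_A ↑v - f ↑v + J (γ ↑w) (γ ↑v) := fun w =>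
    hFlip.add ((hJ_lip (γ w)).comp (γ.comp Vh.subtypeL).lipschitz.locallyLipschitz)
  have hle : ∀ w u v : Vh,
      clarkeDeriv (fun v : Vh => F_A ↑v - f ↑v + J (γ ↑w) (γ ↑v)) u v
        ≤ (A u - f) v + clarkeDeriv (J (γ w)) (γ u) (γ v) := fun w u v =>
    clarkeDeriv_add_comp_le (hstrict u) (γ.comp Vh.subtypeL) (hJ_lip (γ w)) (hφ w) v
  refine existsUnique_zero_mem_clarkeSubdiff (c := m_A - m_α * ‖γ‖ ^ 2) (k := m_L * ‖γ‖ ^ 2)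
    hφ (by positivity) (by linarith) fun w₁ w₂ v₁ v₂ => ?_
  have h₁ := hle w₁ v₁ (v₂ - v₁)
  have h₂ := hle w₂ v₂ (v₁ - v₂)
  have hJ := hJ_mono (γ w₁) (γ w₂) (γ v₁) (γ v₂)
  have hA := hA_mono v₁ v₂
  have hv : ‖γ v₁ - γ v₂‖ ≤ ‖γ‖ * ‖v₁ - v₂‖ := by
    rw [← map_sub]; exact γ.le_opNorm _
  have hw : ‖γ w₁ - γ w₂‖ ≤ ‖γ‖ * ‖w₁ - w₂‖ := by
    rw [← map_sub]; exact γ.le_opNorm _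
  have hv2 : m_α * ‖γ v₁ - γ v₂‖ ^ 2 ≤ m_α * (‖γ‖ * ‖v₁ - v₂‖) ^ 2 := by gcongr
  have hwv : m_L * ‖γ w₁ - γ w₂‖ * ‖γ v₁ - γ v₂‖
      ≤ m_L * (‖γ‖ * ‖w₁ - w₂‖) * (‖γ‖ * ‖v₁ - v₂‖) := by gcongr
  have hnorm : ‖(v₁ : V) - v₂‖ = ‖v₁ - v₂‖ := rfl
  rw [hnorm] at hA
  simp only [Submodule.coe_sub, map_sub, sub_apply] at h₁ h₂ hA
  nlinarith
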